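/- arXiv:0810.5362 — 4 statements merged into one kernel-verified Lean document; each statement's English description precedes it below -/
import Mathlib

section
/- (Eriksson's Strong Convergence Theorem.) Let (Γ,M) be a connected GCM graph and let λ be any position on it. Then any two game sequences from λ either are both divergent, or are both convergent with the same terminal position and the same number of firings. -/
/-- A generalized Cartan matrix on index set `I`. -/
def IsGCM {I : Type*} (M : I → I → ℤ) : Prop :=
  (∀ i, M i i = 2) ∧ (∀ i j, i ≠ j → M i j ≤ 0) ∧
    (∀ i j, i ≠ j → (M i j ≠ 0 ↔ M j i ≠ 0))

/-- Firing node `i` transforms the position `lam` by `lam j ↦ lam j - M i j * lam i`. -/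
def fire {I : Type*} (M : I → I → ℤ) (lam : I → ℝ) (i : I) : I → ℝ :=
  fun j => lam j - (M i j : ℝ) * lam i

/-- The position obtained from `lam` by firing the nodes of a list in order. -/
def fireList {I : Type*} (M : I → I → ℤ) : (I → ℝ) → List I → (I → ℝ)
  | lam, [] => lam
  | lam, i :: s => fireList M (fire M lam i) s

/-- A list of node firings is legal from `lam` if each successive firing is at a node
with a positive number. -/
def LegalSeq {I : Type*} (M : I → I → ℤ) : (I → ℝ) → List I → Prop
  | _, [] => True
  | lam, i :: s => 0 < lam i ∧ LegalSeq M (fire M lam i) s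

/-- A convergent game sequence from `lam`: a legal firing sequence after which
no node has a positive number. -/
def ConvGame {I : Type*} (M : I → I → ℤ) (lam : I → ℝ) (s : List I) : Prop :=
  LegalSeq M lam s ∧ ∀ i, fireList M lam s i ≤ 0

/-- The sequence of positions along an infinite firing sequence `f`. -/
def posSeq {I : Type*} (M : I → I → ℤ) (lam : I → ℝ) (f : ℕ → I) : ℕ → (I → ℝ)
  | 0 => lam
  | k + 1 => fire M (posSeq M lam f k) (f k)

/-- A divergent game sequence from `lam`: an infinite sequence of legal firings. -/
def DivGame {I : Type*} (M : I → I → ℤ) (lam : I → ℝ) (f : ℕ → I) : Prop :=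
  ∀ k, 0 < posSeq M lam f k (f k)

theorem legalSeq_append {I : Type*} {M : I → I → ℤ} (s t : List I) (lam : I → ℝ) :
    LegalSeq M lam (s ++ t) ↔ LegalSeq M lam s ∧ LegalSeq M (fireList M lam s) t := by
  induction s generalizing lam with
  | nil => simp [LegalSeq, fireList]
  | cons i s ih => simp [LegalSeq, fireList, ih, and_assoc]

theorem fireList_append {I : Type*} {M : I → I → ℤ} (s t : List I) (lam : I → ℝ) :
    fireList M lam (s ++ t) = fireList M (fireList M lam s) t := by
  induction s generalizing lam with
  | nil => rfl
  | cons i s ih => simp [fireList, ih]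

theorem ConvGame.append {I : Type*} {M : I → I → ℤ} {lam : I → ℝ} {s t : List I}
    (hs : LegalSeq M lam s) (ht : ConvGame M (fireList M lam s) t) :
    ConvGame M lam (s ++ t) :=
  ⟨(legalSeq_append s t lam).2 ⟨hs, ht.1⟩, by rw [fireList_append]; exact ht.2⟩

/-- If the lengths of legal firing sequences are bounded, a convergent game exists. -/
theorem exists_convGame_of_length_le {I : Type*} {M : I → I → ℤ} (n : ℕ) (lam : I → ℝ)
    (h : ∀ t, LegalSeq M lam t → t.length ≤ n) : ∃ u, ConvGame M lam u := by
  induction n generalizing lam with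
  | zero =>
    refine ⟨[], trivial, fun i => ?_⟩
    by_contra! hi
    simpa using h [i] ⟨hi, trivial⟩
  | succ n ih =>
    by_cases hpos : ∃ i, 0 < lam i
    · obtain ⟨i, hi⟩ := hpos
      obtain ⟨u, hu⟩ := ih (fire M lam i) fun t ht => by
        simpa using h (i :: t) ⟨hi, ht⟩
      exact ⟨i :: u, ⟨hi, hu.1⟩, hu.2⟩
    · push Not at hpos
      exact ⟨[], trivial, hpos⟩

/-- When `M i j * M j i ≥ 4`, firing `i` and `j` alternately can go on forever. -/
theorem exists_legalSeq_length_eq {I : Type*} {M : I → I → ℤ} (hM : ∀ i, M i i = 2) (n : ℕ)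
    (i j : I) (lam : I → ℝ) (hij : M i j < 0) (hji : M j i < 0) (h4 : 4 ≤ M i j * M j i)
    (hj : 0 < lam j) (hi : 0 ≤ 2 * lam i - M j i * lam j) :
    ∃ t : List I, t.length = n ∧ LegalSeq M lam t := by
  induction n generalizing i j lam with
  | zero => exact ⟨[], rfl, trivial⟩
  | succ n ih =>
    have hij' : (M i j : ℝ) < 0 := by exact_mod_cast hij
    have hji' : (M j i : ℝ) < 0 := by exact_mod_cast hji
    have h4' : (4 : ℝ) ≤ M i j * M j i := by exact_mod_cast h4
    obtain ⟨t, htl, ht⟩ := ih j i (fire M lam j) hji hij (by linarith)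
      (by simp only [fire]; nlinarith [mul_pos_of_neg_of_neg hji' (neg_neg_of_pos hj)])
      (by
        simp only [fire, hM]
        push_cast
        nlinarith [mul_nonneg (neg_nonneg.2 hij'.le) hi,
          mul_nonneg (sub_nonneg.2 h4') hj.le])
    exact ⟨j :: t, by simp [htl], hj, ht⟩

/-- When `M i j * M j i < 4`, the two alternating sequences starting at `i` and at `j`
can be played legally until they meet. -/
theorem exists_meet_of_mul_lt_four {I : Type*} {M : I → I → ℤ} (hM : IsGCM M) (i j : I)
    (hne : i ≠ j) (h4 : M i j * M j i < 4) (lam : I → ℝ) (hi : 0 < lam i) (hj : 0 < lam j) :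
    ∃ p q : List I, p.length = q.length ∧ LegalSeq M (fire M lam i) p ∧
      LegalSeq M (fire M lam j) q ∧
      fireList M (fire M lam i) p = fireList M (fire M lam j) q := by
  wlog hle : M i j ≤ M j i generalizing i j
  · obtain ⟨p, q, hl, hp, hq, h⟩ :=
      this j i hne.symm (by linarith) hj hi (by linarith)
    exact ⟨q, p, hl.symm, hq, hp, h.symm⟩
  have hii := hM.1 i
  have hjj := hM.1 j
  have h1 := hM.2.1 i j hne
  have h2 := hM.2.1 j i hne.symm
  have h3 := hM.2.2 i j hne
  have hcases : (M i j = 0 ∧ M j i = 0) ∨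
      ((M i j = -1 ∨ M i j = -2 ∨ M i j = -3) ∧ M j i = -1) := by
    by_cases h0 : M i j = 0
    · exact .inl ⟨h0, by tauto⟩
    · have h0' : M j i ≠ 0 := h3.1 h0
      have h5 : M j i ≤ -1 := by omega
      have h6 : M j i = -1 := by
        by_contra h7
        have h8 : M j i ≤ -2 := by omega
        nlinarith
      rw [h6] at h4
      exact .inr ⟨by omega, h6⟩
  rcases hcases with ⟨a, b⟩ | ⟨a | a | a, b⟩
  · refine ⟨[j], [i], rfl, ?_, ?_, ?_⟩
    · simp [LegalSeq, fire, a, hj]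
    · simp [LegalSeq, fire, b, hi]
    · ext k; simp [fireList, fire, a, b]; ring
  · refine ⟨[j, i], [i, j], rfl, ?_, ?_, ?_⟩
    · simp only [LegalSeq, fire, a, b, hii]; push_cast; refine ⟨?_, ?_, trivial⟩ <;> linarith
    · simp only [LegalSeq, fire, a, b, hjj]; push_cast; refine ⟨?_, ?_, trivial⟩ <;> linarith
    · ext k; simp only [fireList, fire, a, b, hii, hjj]; push_cast; ring
  · refine ⟨[j, i, j], [i, j, i], rfl, ?_, ?_, ?_⟩
    · simp only [LegalSeq, fire, a, b, hii, hjj]; push_cast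
      refine ⟨?_, ?_, ?_, trivial⟩ <;> linarith
    · simp only [LegalSeq, fire, a, b, hii, hjj]; push_cast
      refine ⟨?_, ?_, ?_, trivial⟩ <;> linarith
    · ext k; simp only [fireList, fire, a, b, hii, hjj]; push_cast; ring
  · refine ⟨[j, i, j, i, j], [i, j, i, j, i], rfl, ?_, ?_, ?_⟩
    · simp only [LegalSeq, fire, a, b, hii, hjj]; push_cast
      refine ⟨?_, ?_, ?_, ?_, ?_, trivial⟩ <;> linarith
    · simp only [LegalSeq, fire, a, b, hii, hjj]; push_cast
      refine ⟨?_, ?_, ?_, ?_, ?_, trivial⟩ <;> linarith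
    · ext k; simp only [fireList, fire, a, b, hii, hjj]; push_cast; ring

/-- A convergent game bounds the length of all legal sequences and determines the length
and terminal position of all convergent ones. -/
theorem ConvGame.length_le_and_unique {I : Type*} {M : I → I → ℤ} (hM : IsGCM M) {n : ℕ}
    {lam : I → ℝ} {s : List I} (hs : ConvGame M lam s) (hn : s.length = n) :
    (∀ t, LegalSeq M lam t → t.length ≤ n) ∧
      ∀ t, ConvGame M lam t → t.length = n ∧ fireList M lam t = fireList M lam s := by
  induction n generalizing lam s with
  | zero =>
    obtain rfl := List.length_eq_zero_iff.1 hn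
    have h : ∀ t, LegalSeq M lam t → t = [] := by
      rintro (_ | ⟨j, t⟩) ht
      · rfl
      · exact absurd ht.1 (not_lt.2 (hs.2 j))
    exact ⟨fun t ht => by simp [h t ht], fun t ht => by simp [h t ht.1]⟩
  | succ n ih =>
    obtain _ | ⟨i, s⟩ := s
    · simp at hn
    have hn' : s.length = n := by simpa using hn
    have hi : 0 < lam i := hs.1.1
    have hs' : ConvGame M (fire M lam i) s := ⟨hs.1.2, hs.2⟩
    obtain ⟨hbound, huniq⟩ := ih hs' hn'
    have key : ∀ j, 0 < lam j → ∃ w, ConvGame M (fire M lam j) w ∧ w.length = n ∧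
        fireList M (fire M lam j) w = fireList M (fire M lam i) s := by
      intro j hj
      obtain rfl | hne := eq_or_ne i j
      · exact ⟨s, hs', hn', rfl⟩
      obtain h4 | h4 := lt_or_ge (M i j * M j i) 4
      · obtain ⟨p, q, hl, hp, hq, hpq⟩ := exists_meet_of_mul_lt_four hM i j hne h4 lam hi hj
        obtain ⟨u, hu⟩ := exists_convGame_of_length_le n (fireList M (fire M lam i) p)
          fun t ht => by
            have := hbound (p ++ t) ((legalSeq_append p t _).2 ⟨hp, ht⟩)
            simp only [List.length_append] at this
            omega
        obtain ⟨h1, h2⟩ := huniq _ (ConvGame.append hp hu)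
        refine ⟨q ++ u, ConvGame.append hq (hpq ▸ hu), ?_, ?_⟩
        · simpa [hl] using h1
        · rw [← h2, fireList_append, fireList_append, hpq]
      · have hij : M i j < 0 := lt_of_le_of_ne (hM.2.1 i j hne) fun h => by simp [h] at h4
        have hji : M j i < 0 := lt_of_le_of_ne (hM.2.1 j i hne.symm) fun h => by simp [h] at h4
        have hij' : (M i j : ℝ) < 0 := by exact_mod_cast hij
        have hji' : (M j i : ℝ) < 0 := by exact_mod_cast hji
        have h4' : (4 : ℝ) ≤ M i j * M j i := by exact_mod_cast h4
        obtain ⟨t, htl, ht⟩ := exists_legalSeq_length_eq hM.1 (n + 1) i j (fire M lam i) hij hji h4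
          (by simp only [fire]; nlinarith [mul_pos (neg_pos.2 hij') hi])
          (by
            simp only [fire, hM.1]
            push_cast
            nlinarith [mul_nonneg (sub_nonneg.2 h4') hi.le, mul_pos (neg_pos.2 hji') hj])
        have := hbound t ht
        omega
    constructor
    · rintro (_ | ⟨j, t⟩) ht
      · simp
      · obtain ⟨w, hw, hwn, -⟩ := key j ht.1
        simpa using (ih hw hwn).1 t ht.2
    · rintro (_ | ⟨j, t⟩) ht
      · exact absurd hi (not_lt.2 (ht.2 i))
      · obtain ⟨w, hw, hwn, hwt⟩ := key j ht.1.1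
        obtain ⟨h1, h2⟩ := (ih hw hwn).2 t ⟨ht.1.2, ht.2⟩
        exact ⟨by simpa using h1, h2.trans hwt⟩

theorem posSeq_succ_eq {I : Type*} (M : I → I → ℤ) (lam : I → ℝ) (f : ℕ → I) (k : ℕ) :
    posSeq M lam f (k + 1) = posSeq M (fire M lam (f 0)) (fun m => f (m + 1)) k := by
  induction k with
  | zero => rfl
  | succ k ih => rw [posSeq, ih, posSeq]

theorem DivGame.exists_legalSeq {I : Type*} {M : I → I → ℤ} {lam : I → ℝ} {f : ℕ → I}
    (hf : DivGame M lam f) (n : ℕ) : ∃ t : List I, t.length = n ∧ LegalSeq M lam t := by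
  induction n generalizing lam f with
  | zero => exact ⟨[], rfl, trivial⟩
  | succ n ih =>
    have hf' : DivGame M (fire M lam (f 0)) fun m => f (m + 1) := fun k => by
      rw [← posSeq_succ_eq]
      exact hf (k + 1)
    obtain ⟨t, htl, ht⟩ := ih hf'
    exact ⟨f 0 :: t, by simp [htl], hf 0, ht⟩

/-- **Eriksson's Strong Convergence Theorem.** On a connected GCM graph, any two game
sequences from the same initial position either both diverge or both converge, and in
the convergent case they reach the same terminal position in the same number of firings. -/
theorem strong_convergence {I : Type*} [Fintype I] (M : I → I → ℤ) (hM : IsGCM M)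
    (hconn : (SimpleGraph.fromRel fun i j => M i j ≠ 0).Connected) (lam : I → ℝ) :
    (∀ s t : List I, ConvGame M lam s → ConvGame M lam t →
      fireList M lam s = fireList M lam t ∧ s.length = t.length) ∧
    (∀ (s : List I) (f : ℕ → I), ConvGame M lam s → DivGame M lam f → False) := by
  refine ⟨fun s t hs ht => ?_, fun s f hs hf => ?_⟩
  · obtain ⟨h1, h2⟩ := (hs.length_le_and_unique hM rfl).2 t ht
    exact ⟨h2.symm, h1.symm⟩
  · obtain ⟨t, htl, ht⟩ := hf.exists_legalSeq (s.length + 1)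
    have := (hs.length_le_and_unique hM rfl).1 t ht
    omega
end

section
/- Let (Γ,M) be any GCM graph (not necessarily connected) and let λ be a position on it. If some game sequence from λ is divergent, then every game sequence from λ is divergent. -/
namespace NumbersGame

variable {I : Type*} {M : I → I → ℤ}

/-- Some convergent game sequence from `lam` has exactly `n` firings. -/
def ConvIn (M : I → I → ℤ) (lam : I → ℝ) (n : ℕ) : Prop :=
  ∃ s : List I, s.length = n ∧ ConvGame M lam s

/-- If `M i j * M j i ≥ 4`, alternating firings of `i` and `j` can be continued for any length. -/
theorem exists_legalSeq_of_four_le {i j : I} (hi : M i i = 2) (hj : M j j = 2)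
    (hij : M i j < 0) (hji : M j i < 0) (h4 : 4 ≤ M i j * M j i) (n : ℕ) (lam : I → ℝ)
    (hpos : 0 < lam i) (hsum : 0 < 2 * lam j - M i j * lam i) :
    ∃ t : List I, t.length = n ∧ LegalSeq M lam t := by
  induction n generalizing lam i j with
  | zero => exact ⟨[], rfl, trivial⟩
  | succ n ih =>
    have hijR : (M i j : ℝ) < 0 := by exact_mod_cast hij
    have hjiR : (M j i : ℝ) < 0 := by exact_mod_cast hji
    have h4R : (4 : ℝ) ≤ M i j * M j i := by exact_mod_cast h4
    obtain ⟨t, ht, hleg⟩ := ih hj hi hji hij (by rwa [mul_comm]) (fire M lam i)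
      (by simp only [fire]; nlinarith [mul_pos_of_neg_of_neg hijR (neg_neg_of_pos hpos)])
      (by
        simp only [fire, hi]
        push_cast
        nlinarith [mul_pos (neg_pos.2 hjiR) hsum, mul_nonneg (sub_nonneg.2 h4R) hpos.le])
    exact ⟨i :: t, by simp [ht], hpos, hleg⟩

/-- Firing either of two positive nodes leads to a common position after equally many further
legal firings, unless play can be continued for any length. -/
theorem exists_join_or_unbounded (hM : IsGCM M) {i j : I} (hne : i ≠ j) (lam : I → ℝ)
    (hi : 0 < lam i) (hj : 0 < lam j) :
    (∃ u v : List I, LegalSeq M (fire M lam i) u ∧ LegalSeq M (fire M lam j) v ∧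
      u.length = v.length ∧ fireList M (fire M lam i) u = fireList M (fire M lam j) v) ∨
    ∀ n, ∃ t : List I, t.length = n ∧ LegalSeq M (fire M lam i) t := by
  obtain ⟨hd, hnp, hz⟩ := hM
  have hii := hd i
  have hjj := hd j
  have hij := hnp i j hne
  have hji := hnp j i hne.symm
  have hzz := hz i j hne
  by_cases h4 : 4 ≤ M i j * M j i
  · right
    intro n
    have hij' : M i j < 0 := lt_of_le_of_ne hij (by rintro h; simp [h] at h4)
    have hji' : M j i < 0 := lt_of_le_of_ne hji (by rintro h; simp [h] at h4)
    have hijR : (M i j : ℝ) < 0 := by exact_mod_cast hij'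
    have hjiR : (M j i : ℝ) < 0 := by exact_mod_cast hji'
    have h4R : (4 : ℝ) ≤ M i j * M j i := by exact_mod_cast h4
    exact exists_legalSeq_of_four_le hjj hii hji' hij' (by rwa [mul_comm]) n (fire M lam i)
      (by simp only [fire]; nlinarith [mul_pos_of_neg_of_neg hijR (neg_neg_of_pos hi)])
      (by
        simp only [fire, hii]
        push_cast
        nlinarith [mul_pos (neg_pos.2 hjiR) hj, mul_nonneg (sub_nonneg.2 h4R) hi.le])
  · left
    have hcases : (M i j = 0 ∧ M j i = 0) ∨ (M i j = -1 ∧ M j i = -1) ∨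
        (M i j = -1 ∧ M j i = -2) ∨ (M i j = -2 ∧ M j i = -1) ∨
        (M i j = -1 ∧ M j i = -3) ∨ (M i j = -3 ∧ M j i = -1) := by
      by_cases h0 : M i j = 0
      · left
        exact ⟨h0, by_contra fun h => hzz.2 h h0⟩
      · have h0' := hzz.1 h0
        have hij' : M i j ≤ -1 := by omega
        have hji' : M j i ≤ -1 := by omega
        have : -3 ≤ M i j := by nlinarith
        have : -3 ≤ M j i := by nlinarith
        generalize M i j = p at *
        generalize M j i = q at *
        interval_cases p <;> interval_cases q <;> simp_all
    rcases hcases with h | h | h | h | h | h <;> obtain ⟨h1, h2⟩ := h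
    · refine ⟨[j], [i], ?_, ?_, rfl, ?_⟩
      all_goals simp only [LegalSeq, fireList]
      · exact ⟨by simpa [fire, h1] using hj, trivial⟩
      · exact ⟨by simpa [fire, h2] using hi, trivial⟩
      · ext k
        simp only [fire, h1, h2]
        push_cast
        ring
    · refine ⟨[j, i], [i, j], ?_, ?_, rfl, ?_⟩
      all_goals simp only [LegalSeq, fireList]
      · refine ⟨?_, ?_, trivial⟩ <;> simp only [fire, hii, h1, h2] <;> push_cast <;> linarith
      · refine ⟨?_, ?_, trivial⟩ <;> simp only [fire, hjj, h1, h2] <;> push_cast <;> linarith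
      · ext k
        simp only [fire, hii, hjj, h1, h2]
        push_cast
        ring
    · refine ⟨[j, i, j], [i, j, i], ?_, ?_, rfl, ?_⟩
      all_goals simp only [LegalSeq, fireList]
      · refine ⟨?_, ?_, ?_, trivial⟩ <;> simp only [fire, hii, hjj, h1, h2] <;> push_cast <;> linarith
      · refine ⟨?_, ?_, ?_, trivial⟩ <;> simp only [fire, hii, hjj, h1, h2] <;> push_cast <;> linarith
      · ext k
        simp only [fire, hii, hjj, h1, h2]
        push_cast
        ring
    · refine ⟨[j, i, j], [i, j, i], ?_, ?_, rfl, ?_⟩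
      all_goals simp only [LegalSeq, fireList]
      · refine ⟨?_, ?_, ?_, trivial⟩ <;> simp only [fire, hii, hjj, h1, h2] <;> push_cast <;> linarith
      · refine ⟨?_, ?_, ?_, trivial⟩ <;> simp only [fire, hii, hjj, h1, h2] <;> push_cast <;> linarith
      · ext k
        simp only [fire, hii, hjj, h1, h2]
        push_cast
        ring
    · refine ⟨[j, i, j, i, j], [i, j, i, j, i], ?_, ?_, rfl, ?_⟩
      all_goals simp only [LegalSeq, fireList]
      · refine ⟨?_, ?_, ?_, ?_, ?_, trivial⟩ <;> simp only [fire, hii, hjj, h1, h2] <;> push_cast <;> linarith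
      · refine ⟨?_, ?_, ?_, ?_, ?_, trivial⟩ <;> simp only [fire, hii, hjj, h1, h2] <;> push_cast <;> linarith
      · ext k
        simp only [fire, hii, hjj, h1, h2]
        push_cast
        ring
    · refine ⟨[j, i, j, i, j], [i, j, i, j, i], ?_, ?_, rfl, ?_⟩
      all_goals simp only [LegalSeq, fireList]
      · refine ⟨?_, ?_, ?_, ?_, ?_, trivial⟩ <;> simp only [fire, hii, hjj, h1, h2] <;> push_cast <;> linarith
      · refine ⟨?_, ?_, ?_, ?_, ?_, trivial⟩ <;> simp only [fire, hii, hjj, h1, h2] <;> push_cast <;> linarith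
      · ext k
        simp only [fire, hii, hjj, h1, h2]
        push_cast
        ring

theorem ConvIn.cons {lam : I → ℝ} {i : I} {n : ℕ} (hi : 0 < lam i)
    (h : ConvIn M (fire M lam i) n) : ConvIn M lam (n + 1) := by
  obtain ⟨s, hs, hleg, hend⟩ := h
  exact ⟨i :: s, by simp [hs], ⟨hi, hleg⟩, hend⟩

theorem ConvIn.of_fireList {lam : I → ℝ} {t : List I} {n : ℕ} (ht : LegalSeq M lam t)
    (h : ConvIn M (fireList M lam t) n) : ConvIn M lam (n + t.length) := by
  induction t generalizing lam with
  | nil => exact h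
  | cons i t ih => exact (ih ht.2 h).cons ht.1

/-- If single firings shorten games of length at most `n` by one, then legal sequences shorten
such games by their length. -/
theorem ConvIn.fireList_of_fire {n : ℕ}
    (hfire : ∀ m ≤ n, ∀ (lam : I → ℝ) (j : I), ConvIn M lam m → 0 < lam j →
      ∃ k, m = k + 1 ∧ ConvIn M (fire M lam j) k)
    {lam : I → ℝ} {t : List I} (h : ConvIn M lam n) (ht : LegalSeq M lam t) :
    ∃ k, n = k + t.length ∧ ConvIn M (fireList M lam t) k := by
  induction t generalizing n lam with
  | nil => exact ⟨n, rfl, h⟩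
  | cons i t ih =>
    obtain ⟨k, rfl, hk⟩ := hfire n le_rfl lam i h ht.1
    obtain ⟨l, rfl, hl⟩ := ih (fun m hm => hfire m (by omega)) hk ht.2
    exact ⟨l, by simp [add_assoc], hl⟩

/-- Any legal firing shortens the convergent games by exactly one. -/
theorem ConvIn.fire (hM : IsGCM M) {n : ℕ} {lam : I → ℝ} {j : I} (h : ConvIn M lam n)
    (hj : 0 < lam j) : ∃ k, n = k + 1 ∧ ConvIn M (fire M lam j) k := by
  induction n using Nat.strong_induction_on generalizing lam j with
  | _ n ih =>
    obtain ⟨s, rfl, hleg, hend⟩ := h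
    cases s with
    | nil => exact absurd hj (not_lt.2 (hend j))
    | cons i s =>
      have hconv : ConvIn M (_root_.fire M lam i) s.length := ⟨s, rfl, hleg.2, hend⟩
      refine ⟨s.length, rfl, ?_⟩
      obtain rfl | hne := eq_or_ne i j
      · exact hconv
      have hfire : ∀ m ≤ s.length, ∀ (mu : I → ℝ) (k : I), ConvIn M mu m → 0 < mu k →
          ∃ l, m = l + 1 ∧ ConvIn M (_root_.fire M mu k) l :=
        fun m hm mu k => ih m (by simp; omega)
      obtain ⟨u, v, hu, hv, hlen, heq⟩ | hunb := exists_join_or_unbounded hM hne lam hleg.1 hj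
      · obtain ⟨k, hk, hku⟩ := hconv.fireList_of_fire hfire hu
        rw [hk, hlen]
        exact ConvIn.of_fireList hv (heq ▸ hku)
      · obtain ⟨t, ht, htleg⟩ := hunb (s.length + 1)
        obtain ⟨k, hk, -⟩ := hconv.fireList_of_fire hfire htleg
        omega

theorem not_convIn_posSeq (hM : IsGCM M) {lam : I → ℝ} {f : ℕ → I} (hf : DivGame M lam f)
    (n k : ℕ) : ¬ ConvIn M (posSeq M lam f k) n := by
  induction n generalizing k with
  | zero => exact fun h => by simpa using h.fire hM (hf k)
  | succ n ih =>
    intro h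
    obtain ⟨m, hm, hconv⟩ := h.fire hM (hf k)
    obtain rfl : n = m := by omega
    exact ih (k + 1) hconv

end NumbersGame

/-- If some game sequence from `lam` diverges, then all game sequences from `lam`
diverge (i.e. there is no convergent game sequence from `lam`). -/
theorem divergent_all {I : Type*} [Fintype I] (M : I → I → ℤ) (hM : IsGCM M)
    (lam : I → ℝ) (f : ℕ → I) (hf : DivGame M lam f) :
    ¬ ∃ s : List I, ConvGame M lam s := by
  rintro ⟨s, hs⟩
  exact NumbersGame.not_convIn_posSeq hM hf s.length 0 ⟨s, rfl, hs⟩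
end

section
/- (Eriksson's Comparison Theorem.) Let (Γ,M) be a GCM graph and suppose some game sequence from the position λ = (λ_i)_{i ∈ I} is convergent. If λ' = (λ'_i)_{i ∈ I} is a position with λ'_i ≤ λ_i for all i ∈ I, then some game sequence from λ' is convergent. -/
/-- Some legal sequence of exactly `n` firings from `lam` leaves no positive number. -/
def ConvIn {I : Type*} (M : I → I → ℤ) : ℕ → (I → ℝ) → Prop
  | 0, lam => ∀ i, lam i ≤ 0
  | n + 1, lam => ∃ k, 0 < lam k ∧ ConvIn M n (fire M lam k)

theorem ConvGame.convIn {I : Type*} {M : I → I → ℤ} {s : List I} {lam : I → ℝ}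
    (h : ConvGame M lam s) : ConvIn M s.length lam := by
  induction s generalizing lam with
  | nil => exact h.2
  | cons k s ih => exact ⟨k, h.1.1, ih ⟨h.1.2, h.2⟩⟩

theorem ConvIn.exists_convGame {I : Type*} {M : I → I → ℤ} {n : ℕ} {lam : I → ℝ}
    (h : ConvIn M n lam) : ∃ s, ConvGame M lam s := by
  induction n generalizing lam with
  | zero => exact ⟨[], trivial, h⟩
  | succ n ih =>
    obtain ⟨k, hk, hn⟩ := h
    obtain ⟨s, hs, hs'⟩ := ih hn
    exact ⟨k :: s, ⟨hk, hs⟩, hs'⟩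

theorem fire_smul {I : Type*} (M : I → I → ℤ) (t : ℝ) (lam : I → ℝ) (k : I) :
    fire M (t • lam) k = t • fire M lam k := by
  funext j
  simp only [fire, Pi.smul_apply, smul_eq_mul]
  ring

theorem ConvIn.smul {I : Type*} {M : I → I → ℤ} {n : ℕ} {lam : I → ℝ}
    (h : ConvIn M n lam) {t : ℝ} (ht : 0 < t) : ConvIn M n (t • lam) := by
  induction n generalizing lam with
  | zero => exact fun i => mul_nonpos_of_nonneg_of_nonpos ht.le (h i)
  | succ n ih =>
    obtain ⟨k, hk, hn⟩ := h
    refine ⟨k, mul_pos ht hk, ?_⟩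
    rw [fire_smul]
    exact ih hn

/-- The strong convergence property for games of length `n`: every legal first move
decreases the length of the game by one. -/
def StrongConv {I : Type*} (M : I → I → ℤ) (n : ℕ) : Prop :=
  ∀ lam : I → ℝ, ConvIn M n lam → ∀ i, 0 < lam i →
    ∃ m, n = m + 1 ∧ ConvIn M m (fire M lam i)

/-- If `M i k * M k i ≥ 4`, then after firing `i` the nodes `i` and `k` can be fired
alternately forever, so the game cannot have finite length. -/
theorem not_convIn_of_four_le {I : Type*} {M : I → I → ℤ} (hM : IsGCM M) {n : ℕ}
    (hS : ∀ m ≤ n, StrongConv M m) {i k : I} (hik : i ≠ k) (h4 : 4 ≤ M i k * M k i)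
    {lam : I → ℝ} (hi : lam i < 0) (hk : (M i k : ℝ) * lam i ≤ 2 * lam k) :
    ¬ ConvIn M n lam := by
  induction n generalizing i k lam with
  | zero =>
    intro h
    have hneg : M i k ≤ -1 := by
      have h1 := hM.2.1 i k hik
      by_contra hc
      have h0 : M i k = 0 := by omega
      simp [h0] at h4
    have hneg' : (M i k : ℝ) ≤ -1 := by exact_mod_cast hneg
    have := h k
    nlinarith
  | succ n ih =>
    intro h
    have hneg : M i k ≤ -1 := by
      have h1 := hM.2.1 i k hik
      by_contra hc
      have h0 : M i k = 0 := by omega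
      simp [h0] at h4
    have hneg' : (M i k : ℝ) ≤ -1 := by exact_mod_cast hneg
    have hpos : 0 < lam k := by nlinarith
    obtain ⟨m, hm, hc⟩ := hS (n + 1) le_rfl lam h k hpos
    obtain rfl : n = m := by omega
    refine ih (fun m hm => hS m (by omega)) hik.symm (by linarith [mul_comm (M i k) (M k i)])
      ?_ ?_ hc
    · simp only [fire, hM.1]
      push_cast
      linarith
    · have h4' : (4 : ℝ) ≤ (M i k : ℝ) * M k i := by exact_mod_cast h4
      have hki : (M k i : ℝ) ≤ 0 := by exact_mod_cast hM.2.1 k i hik.symm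
      have h1 := mul_le_mul_of_nonpos_left hk hki
      have h2 := mul_le_mul_of_nonpos_right h4' hi.le
      simp only [fire, hM.1]
      push_cast
      linarith

/-- The possible off-diagonal entries when `M i k * M k i < 4`. -/
theorem IsGCM.entries {I : Type*} {M : I → I → ℤ} (hM : IsGCM M) {i k : I} (hik : i ≠ k)
    (h4 : M i k * M k i < 4) :
    (M i k = 0 ∧ M k i = 0) ∨ (M i k = -1 ∧ M k i = -1) ∨
    (M i k = -1 ∧ M k i = -2) ∨ (M i k = -2 ∧ M k i = -1) ∨
    (M i k = -1 ∧ M k i = -3) ∨ (M i k = -3 ∧ M k i = -1) := by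
  have h1 := hM.2.1 i k hik
  have h2 := hM.2.1 k i hik.symm
  have h3 := hM.2.2 i k hik
  generalize M i k = p at *
  generalize M k i = q at *
  by_cases hp : p = 0
  · left
    exact ⟨hp, by tauto⟩
  · have hq : q ≠ 0 := h3.1 hp
    have hp' : p ≤ -1 := by omega
    have hq' : q ≤ -1 := by omega
    have hp3 : -3 ≤ p := by nlinarith
    have hq3 : -3 ≤ q := by nlinarith
    interval_cases p <;> interval_cases q <;> simp_all

set_option linter.unusedSimpArgs false in
theorem strongConv {I : Type*} {M : I → I → ℤ} (hM : IsGCM M) (n : ℕ) :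
    StrongConv M n := by
  induction n using Nat.strong_induction_on with
  | _ n ih =>
  intro lam h i hi
  match n, ih, h with
  | 0, _, h => exact absurd (h i) (not_le.2 hi)
  | n + 1, ih, h =>
  refine ⟨n, rfl, ?_⟩
  obtain ⟨k, hk, hn⟩ := h
  by_cases hki : k = i
  · exact hki ▸ hn
  have hik : i ≠ k := fun e => hki e.symm
  have hii := hM.1 i
  have hkk := hM.1 k
  by_cases h4 : 4 ≤ M k i * M i k
  · refine absurd hn (not_convIn_of_four_le hM (fun m hm => ih m (by omega)) hki h4 ?_ ?_)
    · simp only [fire, hkk]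
      push_cast
      linarith
    · have h1 : (M k i : ℝ) ≤ 0 := by exact_mod_cast hM.2.1 k i hki
      have h2 := mul_nonpos_of_nonpos_of_nonneg h1 hk.le
      simp only [fire, hkk]
      push_cast
      linarith
  rw [not_le, mul_comm] at h4
  rcases hM.entries hik h4 with ⟨a, b⟩ | ⟨a, b⟩ | ⟨a, b⟩ | ⟨a, b⟩ | ⟨a, b⟩ | ⟨a, b⟩
  · obtain ⟨n0, e0, c0⟩ := ih _ (by omega) _ hn i
      (by simp only [fire, hii, hkk, a, b]; push_cast; linarith)
    obtain rfl : n = n0 + 1 := by omega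
    refine
      ⟨k, by simp only [fire, hii, hkk, a, b]; push_cast; linarith, ?_⟩
    convert c0 using 1
    funext j
    simp only [fire, hii, hkk, a, b]
    push_cast
    ring
  · obtain ⟨n0, e0, c0⟩ := ih _ (by omega) _ hn i
      (by simp only [fire, hii, hkk, a, b]; push_cast; linarith)
    obtain ⟨n1, e1, c1⟩ := ih _ (by omega) _ c0 k
      (by simp only [fire, hii, hkk, a, b]; push_cast; linarith)
    obtain rfl : n = n1 + 2 := by omega
    refine
      ⟨k, by simp only [fire, hii, hkk, a, b]; push_cast; linarith,
      ⟨i, by simp only [fire, hii, hkk, a, b]; push_cast; linarith, ?_⟩⟩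
    convert c1 using 1
    funext j
    simp only [fire, hii, hkk, a, b]
    push_cast
    ring
  · obtain ⟨n0, e0, c0⟩ := ih _ (by omega) _ hn i
      (by simp only [fire, hii, hkk, a, b]; push_cast; linarith)
    obtain ⟨n1, e1, c1⟩ := ih _ (by omega) _ c0 k
      (by simp only [fire, hii, hkk, a, b]; push_cast; linarith)
    obtain ⟨n2, e2, c2⟩ := ih _ (by omega) _ c1 i
      (by simp only [fire, hii, hkk, a, b]; push_cast; linarith)
    obtain rfl : n = n2 + 3 := by omega
    refine
      ⟨k, by simp only [fire, hii, hkk, a, b]; push_cast; linarith,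
      ⟨i, by simp only [fire, hii, hkk, a, b]; push_cast; linarith,
      ⟨k, by simp only [fire, hii, hkk, a, b]; push_cast; linarith, ?_⟩⟩⟩
    convert c2 using 1
    funext j
    simp only [fire, hii, hkk, a, b]
    push_cast
    ring
  · obtain ⟨n0, e0, c0⟩ := ih _ (by omega) _ hn i
      (by simp only [fire, hii, hkk, a, b]; push_cast; linarith)
    obtain ⟨n1, e1, c1⟩ := ih _ (by omega) _ c0 k
      (by simp only [fire, hii, hkk, a, b]; push_cast; linarith)
    obtain ⟨n2, e2, c2⟩ := ih _ (by omega) _ c1 i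
      (by simp only [fire, hii, hkk, a, b]; push_cast; linarith)
    obtain rfl : n = n2 + 3 := by omega
    refine
      ⟨k, by simp only [fire, hii, hkk, a, b]; push_cast; linarith,
      ⟨i, by simp only [fire, hii, hkk, a, b]; push_cast; linarith,
      ⟨k, by simp only [fire, hii, hkk, a, b]; push_cast; linarith, ?_⟩⟩⟩
    convert c2 using 1
    funext j
    simp only [fire, hii, hkk, a, b]
    push_cast
    ring
  · obtain ⟨n0, e0, c0⟩ := ih _ (by omega) _ hn i
      (by simp only [fire, hii, hkk, a, b]; push_cast; linarith)
    obtain ⟨n1, e1, c1⟩ := ih _ (by omega) _ c0 k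
      (by simp only [fire, hii, hkk, a, b]; push_cast; linarith)
    obtain ⟨n2, e2, c2⟩ := ih _ (by omega) _ c1 i
      (by simp only [fire, hii, hkk, a, b]; push_cast; linarith)
    obtain ⟨n3, e3, c3⟩ := ih _ (by omega) _ c2 k
      (by simp only [fire, hii, hkk, a, b]; push_cast; linarith)
    obtain ⟨n4, e4, c4⟩ := ih _ (by omega) _ c3 i
      (by simp only [fire, hii, hkk, a, b]; push_cast; linarith)
    obtain rfl : n = n4 + 5 := by omega
    refine
      ⟨k, by simp only [fire, hii, hkk, a, b]; push_cast; linarith,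
      ⟨i, by simp only [fire, hii, hkk, a, b]; push_cast; linarith,
      ⟨k, by simp only [fire, hii, hkk, a, b]; push_cast; linarith,
      ⟨i, by simp only [fire, hii, hkk, a, b]; push_cast; linarith,
      ⟨k, by simp only [fire, hii, hkk, a, b]; push_cast; linarith, ?_⟩⟩⟩⟩⟩
    convert c4 using 1
    funext j
    simp only [fire, hii, hkk, a, b]
    push_cast
    ring
  · obtain ⟨n0, e0, c0⟩ := ih _ (by omega) _ hn i
      (by simp only [fire, hii, hkk, a, b]; push_cast; linarith)
    obtain ⟨n1, e1, c1⟩ := ih _ (by omega) _ c0 k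
      (by simp only [fire, hii, hkk, a, b]; push_cast; linarith)
    obtain ⟨n2, e2, c2⟩ := ih _ (by omega) _ c1 i
      (by simp only [fire, hii, hkk, a, b]; push_cast; linarith)
    obtain ⟨n3, e3, c3⟩ := ih _ (by omega) _ c2 k
      (by simp only [fire, hii, hkk, a, b]; push_cast; linarith)
    obtain ⟨n4, e4, c4⟩ := ih _ (by omega) _ c3 i
      (by simp only [fire, hii, hkk, a, b]; push_cast; linarith)
    obtain rfl : n = n4 + 5 := by omega
    refine
      ⟨k, by simp only [fire, hii, hkk, a, b]; push_cast; linarith,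
      ⟨i, by simp only [fire, hii, hkk, a, b]; push_cast; linarith,
      ⟨k, by simp only [fire, hii, hkk, a, b]; push_cast; linarith,
      ⟨i, by simp only [fire, hii, hkk, a, b]; push_cast; linarith,
      ⟨k, by simp only [fire, hii, hkk, a, b]; push_cast; linarith, ?_⟩⟩⟩⟩⟩
    convert c4 using 1
    funext j
    simp only [fire, hii, hkk, a, b]
    push_cast
    ring

/-- Comparison for positions differing at a single node, given the general comparison
for shorter games. -/
theorem convIn_of_le_single {I : Type*} {M : I → I → ℤ} (hM : IsGCM M) {n : ℕ}
    (ih : ∀ m < n, ∀ lam lam' : I → ℝ, ConvIn M m lam → (∀ i, lam' i ≤ lam i) →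
      ∃ r ≤ m, ConvIn M r lam')
    {lam lam' : I → ℝ} (h : ConvIn M n lam) {k : I} (hk : lam' k ≤ lam k)
    (heq : ∀ j, j ≠ k → lam' j = lam j) : ∃ r ≤ n, ConvIn M r lam' := by
  have hle : ∀ i, lam' i ≤ lam i := fun i => by
    by_cases hi : i = k
    · exact hi ▸ hk
    · exact (heq i hi).le
  by_cases hex : ∃ i, i ≠ k ∧ 0 < lam i
  · obtain ⟨i, hik, hi⟩ := hex
    obtain ⟨m, rfl, hm⟩ := strongConv hM n lam h i hi
    obtain ⟨r, hr, hc⟩ := ih m (Nat.lt_succ_self m) _ (fire M lam' i) hm fun j => by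
      simp only [fire, heq i hik]
      linarith [hle j]
    exact ⟨r + 1, by omega, i, by rwa [heq i hik], hc⟩
  · push Not at hex
    by_cases hpos : 0 < lam' k
    · have hlk : 0 < lam k := hpos.trans_le hk
      obtain ⟨m, rfl, hm⟩ := strongConv hM n lam h k hlk
      have ht : 0 < lam' k / lam k := div_pos hpos hlk
      have ht1 : lam' k / lam k ≤ 1 := (div_le_one hlk).2 hk
      have htk : lam' k / lam k * lam k = lam' k := div_mul_cancel₀ _ hlk.ne'
      have hm' := hm.smul ht
      rw [← fire_smul] at hm'
      obtain ⟨r, hr, hc⟩ := ih m (Nat.lt_succ_self m) _ (fire M lam' k) hm' fun j => by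
        simp only [fire, Pi.smul_apply, smul_eq_mul, htk]
        by_cases hj : j = k
        · rw [hj, htk]
        · rw [heq j hj]
          nlinarith [hex j hj]
      exact ⟨r + 1, by omega, k, hpos, hc⟩
    · refine ⟨0, Nat.zero_le n, fun j => ?_⟩
      by_cases hj : j = k
      · exact hj ▸ not_lt.1 hpos
      · exact (heq j hj).trans_le (hex j hj)

theorem convIn_of_le {I : Type*} [Finite I] {M : I → I → ℤ} (hM : IsGCM M) (n : ℕ) :
    ∀ lam lam' : I → ℝ, ConvIn M n lam → (∀ i, lam' i ≤ lam i) →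
      ∃ r ≤ n, ConvIn M r lam' := by
  classical
  have := Fintype.ofFinite I
  induction n using Nat.strong_induction_on with
  | _ n ih =>
  intro lam lam' h hle
  suffices H : ∀ s : Finset I, ∃ r ≤ n, ConvIn M r (s.piecewise lam' lam) by
    simpa using H Finset.univ
  intro s
  induction s using Finset.induction_on with
  | empty => exact ⟨n, le_rfl, by simpa using h⟩
  | insert k s hks ihs =>
    obtain ⟨r, hr, hc⟩ := ihs
    obtain ⟨q, hq, hc'⟩ := convIn_of_le_single hM (fun m hm => ih m (by omega)) hc
      (k := k) (lam' := (insert k s).piecewise lam' lam)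
      (by simpa [hks] using hle k)
      (fun j hj => Finset.piecewise_insert_of_ne _ _ _ hj)
    exact ⟨q, hq.trans hr, hc'⟩

/-- **Eriksson's Comparison Theorem.** If some game sequence from `lam` converges and
`lam' ≤ lam` pointwise, then some game sequence from `lam'` converges. -/
theorem comparison {I : Type*} [Fintype I] (M : I → I → ℤ) (hM : IsGCM M)
    (lam lam' : I → ℝ) (h : ∃ s : List I, ConvGame M lam s)
    (hle : ∀ i, lam' i ≤ lam i) :
    ∃ s : List I, ConvGame M lam' s := by
  obtain ⟨s, hs⟩ := h
  obtain ⟨r, -, hr⟩ := convIn_of_le hM s.length lam lam' hs.convIn hle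
  exact hr.exists_convGame
end

section
/- Let (Γ,M) be a GCM graph and let λ = (λ_i)_{i ∈ I} be a dominant position with λ_j > 0 for some node j. If some game sequence from λ is convergent, then some game sequence from the fundamental position ω_j is convergent. -/
/-- The reflection `β ↦ β - (∑ k, M i k * β k) • αᵢ`, adjoint to firing node `i`. -/
def simpleRefl {I : Type*} [Fintype I] [DecidableEq I] (M : I → I → ℤ) (i : I) :
    Module.End ℝ (I → ℝ) where
  toFun β := β - (∑ k, (M i k : ℝ) * β k) • Pi.single i 1
  map_add' β γ := by
    simp only [Pi.add_apply, mul_add, Finset.sum_add_distrib]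
    module
  map_smul' c β := by
    simp only [Pi.smul_apply, smul_eq_mul, mul_left_comm _ c, ← Finset.mul_sum, RingHom.id_apply]
    module

/-- The product of the simple reflections along a word. -/
def wordProd {I : Type*} [Fintype I] [DecidableEq I] (M : I → I → ℤ) (w : List I) :
    Module.End ℝ (I → ℝ) :=
  (w.map (simpleRefl M)).prod

theorem exists_alternatingWord_add {I : Type*} (s t : I) (k m : ℕ) :
    ∃ u : List I, u.length = k ∧
      CoxeterSystem.alternatingWord s t (k + m) = u ++ CoxeterSystem.alternatingWord s t m := by
  induction k with
  | zero => exact ⟨[], rfl, by simp⟩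
  | succ k ih =>
    obtain ⟨u, hu, h⟩ := ih
    refine ⟨(if Even (k + m) then t else s) :: u, by simp [hu], ?_⟩
    rw [Nat.add_right_comm, CoxeterSystem.alternatingWord_succ', h, List.cons_append]

section WordProd

variable {I : Type*} [Fintype I] [DecidableEq I] {M : I → I → ℤ}

@[simp]
theorem wordProd_nil : wordProd M [] = 1 := rfl

theorem wordProd_cons (i : I) (w : List I) :
    wordProd M (i :: w) = simpleRefl M i * wordProd M w := by
  simp [wordProd]

theorem wordProd_append (v w : List I) :
    wordProd M (v ++ w) = wordProd M v * wordProd M w := by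
  simp [wordProd]

theorem simpleRefl_apply (i : I) (β : I → ℝ) :
    simpleRefl M i β = β - (∑ k, (M i k : ℝ) * β k) • Pi.single i 1 := rfl

theorem sum_add_single_add_single (i s t : I) (β : I → ℝ) (x y : ℝ) :
    ∑ k, (M i k : ℝ) * (β + x • Pi.single s 1 + y • Pi.single t 1 : I → ℝ) k =
      (∑ k, (M i k : ℝ) * β k) + M i s * x + M i t * y := by
  simp [mul_add, Finset.sum_add_distrib, Pi.single_apply]

theorem simpleRefl_left (hM : IsGCM M) (s t : I) (β : I → ℝ) (x y : ℝ) :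
    simpleRefl M s (β + x • Pi.single s 1 + y • Pi.single t 1) =
      β + (-x - (∑ k, (M s k : ℝ) * β k) - M s t * y) • Pi.single s 1 + y • Pi.single t 1 := by
  rw [simpleRefl_apply, sum_add_single_add_single, hM.1]
  push_cast
  module

theorem simpleRefl_right (hM : IsGCM M) (s t : I) (β : I → ℝ) (x y : ℝ) :
    simpleRefl M t (β + x • Pi.single s 1 + y • Pi.single t 1) =
      β + x • Pi.single s 1 + (-y - (∑ k, (M t k : ℝ) * β k) - M t s * x) • Pi.single t 1 := by
  rw [simpleRefl_apply, sum_add_single_add_single, hM.1]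
  push_cast
  module

theorem simpleRefl_single (hM : IsGCM M) (s : I) :
    simpleRefl M s (Pi.single s 1) = -Pi.single s 1 := by
  have := simpleRefl_left hM s s 0 1 0
  simpa using this

theorem simpleRefl_mul_self (hM : IsGCM M) (s : I) :
    simpleRefl M s * simpleRefl M s = 1 := by
  refine LinearMap.ext fun β => ?_
  rw [Module.End.mul_apply, simpleRefl_apply s β, map_sub, map_smul, simpleRefl_single hM,
    simpleRefl_apply, Module.End.one_apply]
  module

/-- One step of the rank two recursion for roots. -/
theorem wordProd_alternatingWord_succ_single (hM : IsGCM M) {s t : I} {m : ℕ} {x y : ℝ}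
    (h : wordProd M (CoxeterSystem.alternatingWord s t m) (Pi.single s 1) =
      x • Pi.single s 1 + y • Pi.single t 1) :
    wordProd M (CoxeterSystem.alternatingWord s t (m + 1)) (Pi.single s 1) =
      if Even m then x • Pi.single s 1 + (-y - M t s * x) • Pi.single t 1
      else (-x - M s t * y) • Pi.single s 1 + y • Pi.single t 1 := by
  rw [CoxeterSystem.alternatingWord_succ', wordProd_cons, Module.End.mul_apply, h]
  have hl := simpleRefl_left hM s t 0 x y
  have hr := simpleRefl_right hM s t 0 x y
  simp only [zero_add, Pi.zero_apply, mul_zero, Finset.sum_const_zero, sub_zero] at hl hr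
  split_ifs <;> assumption

/-- An alternating word extended past a braid relation of length `m₀` can be shortened. -/
theorem exists_shorter_of_braid {s t : I} {m₀ m : ℕ} (h₀ : 0 < m₀) (hm : m₀ ≤ m)
    (h : wordProd M (CoxeterSystem.alternatingWord s t m₀) * simpleRefl M s =
      wordProd M (CoxeterSystem.alternatingWord s t (m₀ - 1))) :
    ∃ u : List I, u.length < m ∧
      wordProd M u = wordProd M (CoxeterSystem.alternatingWord s t m) * simpleRefl M s := by
  obtain ⟨k, rfl⟩ := Nat.exists_eq_add_of_le' hm
  obtain ⟨u, hu, he⟩ := exists_alternatingWord_add s t k m₀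
  refine ⟨u ++ CoxeterSystem.alternatingWord s t (m₀ - 1), ?_, ?_⟩
  · simp [hu]; omega
  · rw [he, wordProd_append, wordProd_append, mul_assoc, h]

theorem exists_nonneg_of_four_le (hM : IsGCM M) {s t : I} (hst : s ≠ t)
    (h4 : 4 ≤ M s t * M t s) (m : ℕ) :
    ∃ x y : ℝ, 0 ≤ x ∧ 0 ≤ y ∧
      wordProd M (CoxeterSystem.alternatingWord s t m) (Pi.single s 1) =
        x • Pi.single s 1 + y • Pi.single t 1 := by
  have ha : (M s t : ℝ) ≤ 0 := by exact_mod_cast hM.2.1 s t hst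
  have hb : (M t s : ℝ) ≤ 0 := by exact_mod_cast hM.2.1 t s hst.symm
  have h4' : (4 : ℝ) ≤ M s t * M t s := by exact_mod_cast h4
  suffices H : ∃ x y : ℝ, 0 ≤ x ∧ 0 ≤ y ∧
      (if Even m then 2 * y ≤ -M t s * x else 2 * x ≤ -M s t * y) ∧
      wordProd M (CoxeterSystem.alternatingWord s t m) (Pi.single s 1) =
        x • Pi.single s 1 + y • Pi.single t 1 by
    obtain ⟨x, y, hx, hy, -, h⟩ := H
    exact ⟨x, y, hx, hy, h⟩
  induction m with
  | zero =>
    exact ⟨1, 0, by simp, by simp, by simpa using hb, by simp [CoxeterSystem.alternatingWord]⟩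
  | succ m ih =>
    obtain ⟨x, y, hx, hy, hxy, h⟩ := ih
    have h' := wordProd_alternatingWord_succ_single hM h
    by_cases hm : Even m
    · rw [if_pos hm] at h' hxy
      refine ⟨x, _, hx, by linarith, ?_, h'⟩
      rw [if_neg (by simpa [Nat.even_add_one] using hm)]
      nlinarith [mul_le_mul_of_nonneg_right h4' hx]
    · rw [if_neg hm] at h' hxy
      refine ⟨_, y, by linarith, hy, ?_, h'⟩
      rw [if_pos (by simpa [Nat.even_add_one] using hm)]
      nlinarith [mul_le_mul_of_nonneg_right h4' hy]

/-- The braid relation and the positive roots for a finite rank two Cartan matrix. -/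
theorem nonneg_or_exists_shorter_of_finite (hM : IsGCM M) {s t : I} (m : ℕ)
    (h : (M s t = 0 ∧ M t s = 0) ∨ (M s t = -1 ∧ M t s = -1) ∨ (M s t = -1 ∧ M t s = -2) ∨
      (M s t = -2 ∧ M t s = -1) ∨ (M s t = -1 ∧ M t s = -3) ∨ (M s t = -3 ∧ M t s = -1)) :
    (∃ x y : ℝ, 0 ≤ x ∧ 0 ≤ y ∧
      wordProd M (CoxeterSystem.alternatingWord s t m) (Pi.single s 1) =
        x • Pi.single s 1 + y • Pi.single t 1) ∨
    ∃ u : List I, u.length < m ∧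
      wordProd M u = wordProd M (CoxeterSystem.alternatingWord s t m) * simpleRefl M s := by
  have h0 : wordProd M (CoxeterSystem.alternatingWord s t 0) (Pi.single s 1) =
      (1 : ℝ) • Pi.single s 1 + (0 : ℝ) • Pi.single t 1 := by
    simp [CoxeterSystem.alternatingWord]
  have h1 := wordProd_alternatingWord_succ_single hM h0
  rw [if_pos (by decide)] at h1
  have h2 := wordProd_alternatingWord_succ_single hM h1
  rw [if_neg (by decide)] at h2
  have h3 := wordProd_alternatingWord_succ_single hM h2
  rw [if_pos (by decide)] at h3
  have h4 := wordProd_alternatingWord_succ_single hM h3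
  rw [if_neg (by decide)] at h4
  have h5 := wordProd_alternatingWord_succ_single hM h4
  rw [if_pos (by decide)] at h5
  obtain ⟨m₀, hm₀, hbraid, hpos⟩ : ∃ m₀, 0 < m₀ ∧
      (wordProd M (CoxeterSystem.alternatingWord s t m₀) * simpleRefl M s =
        wordProd M (CoxeterSystem.alternatingWord s t (m₀ - 1))) ∧
      ∀ m < m₀, ∃ x y : ℝ, 0 ≤ x ∧ 0 ≤ y ∧
        wordProd M (CoxeterSystem.alternatingWord s t m) (Pi.single s 1) =
          x • Pi.single s 1 + y • Pi.single t 1 := by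
    have key (β : I → ℝ) : β = β + (0 : ℝ) • Pi.single s 1 + (0 : ℝ) • Pi.single t 1 := by simp
    rcases h with h | h | h | h | h | h <;>
    [use 2; use 3; use 4; use 4; use 6; use 6] <;>
    refine ⟨by decide, ?_, ?_⟩ <;>
    first
    | (intro m hm
       interval_cases m
       all_goals
         first
         | exact ⟨_, _, by norm_num [h.1, h.2], by norm_num [h.1, h.2], h0⟩
         | exact ⟨_, _, by norm_num [h.1, h.2], by norm_num [h.1, h.2], h1⟩
         | exact ⟨_, _, by norm_num [h.1, h.2], by norm_num [h.1, h.2], h2⟩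
         | exact ⟨_, _, by norm_num [h.1, h.2], by norm_num [h.1, h.2], h3⟩
         | exact ⟨_, _, by norm_num [h.1, h.2], by norm_num [h.1, h.2], h4⟩
         | exact ⟨_, _, by norm_num [h.1, h.2], by norm_num [h.1, h.2], h5⟩)
    | (refine LinearMap.ext fun β => ?_
       rw [key β]
       simp only [CoxeterSystem.alternatingWord, wordProd, List.concat_eq_append, List.nil_append,
         List.cons_append, List.map_cons, List.map_nil, List.prod_cons, List.prod_nil, mul_one,
         Module.End.mul_apply, simpleRefl_left hM, simpleRefl_right hM, h.1, h.2, Nat.reduceSub]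
       push_cast
       module)
  rcases lt_or_ge m m₀ with hm | hm
  · exact Or.inl (hpos m hm)
  · exact Or.inr (exists_shorter_of_braid hm₀ hm hbraid)

theorem nonneg_or_exists_shorter (hM : IsGCM M) {s t : I} (hst : s ≠ t) (m : ℕ) :
    (∃ x y : ℝ, 0 ≤ x ∧ 0 ≤ y ∧
      wordProd M (CoxeterSystem.alternatingWord s t m) (Pi.single s 1) =
        x • Pi.single s 1 + y • Pi.single t 1) ∨
    ∃ u : List I, u.length < m ∧
      wordProd M u = wordProd M (CoxeterSystem.alternatingWord s t m) * simpleRefl M s := by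
  rcases le_or_gt 4 (M s t * M t s) with h4 | h4
  · exact Or.inl (exists_nonneg_of_four_le hM hst h4 m)
  · refine nonneg_or_exists_shorter_of_finite hM m ?_
    have ha := hM.2.1 s t hst
    have hb := hM.2.1 t s hst.symm
    have hab := hM.2.2 s t hst
    generalize M s t = a at *
    generalize M t s = b at *
    by_cases ha0 : a = 0
    · have : b = 0 := by simpa [ha0] using hab
      omega
    · have hb0 : b ≠ 0 := hab.1 ha0
      have ha1 : -3 ≤ a := by by_contra! hlt; nlinarith [show b ≤ -1 by omega]
      have hb1 : -3 ≤ b := by by_contra! hlt; nlinarith [show a ≤ -1 by omega]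
      interval_cases a <;> interval_cases b <;> simp_all

/-- If right multiplication by `s` does not shorten a reduced word, the word sends the simple
root of `s` to a nonnegative vector. -/
theorem wordProd_single_nonneg (hM : IsGCM M) (n : ℕ) : ∀ (w : List I) (s : I), w.length = n →
    (∀ w', wordProd M w' = wordProd M w → n ≤ w'.length) →
    (∀ w', wordProd M w' = wordProd M w * simpleRefl M s → n ≤ w'.length) →
    0 ≤ wordProd M w (Pi.single s 1) := by
  induction n using Nat.strong_induction_on with
  | _ n ih =>
  intro w s hn hred hasc
  rcases List.eq_nil_or_concat w with rfl | ⟨w₀, t, rfl⟩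
  · simp
  rw [List.concat_eq_append] at *
  have hw₀ : w₀.length + 1 = n := by simpa using hn
  have hst : s ≠ t := by
    rintro rfl
    have := hasc w₀ (by
      rw [wordProd_append, mul_assoc, wordProd_cons, wordProd_nil, mul_one,
        simpleRefl_mul_self hM, mul_one])
    omega
  generalize hg : wordProd M (w₀ ++ [t]) = g at *
  classical
  let P : ℕ → Prop := fun m => ∃ v : List I, v.length + m = n ∧
    wordProd M v * wordProd M (CoxeterSystem.alternatingWord s t m) = g
  have hP1 : P 1 := ⟨w₀, hw₀, by
    rw [← hg, wordProd_append]; simp [CoxeterSystem.alternatingWord]⟩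
  have h1n : 1 ≤ n := by omega
  obtain ⟨m, hm1, ⟨v, hvn, hv⟩, hmax⟩ : ∃ m, 1 ≤ m ∧ P m ∧ ¬ P (m + 1) := by
    refine ⟨Nat.findGreatest P n, Nat.le_findGreatest h1n hP1, Nat.findGreatest_spec h1n hP1, ?_⟩
    intro hP
    obtain ⟨v, hv, -⟩ := id hP
    have := Nat.le_findGreatest (show Nat.findGreatest P n + 1 ≤ n by omega) hP
    omega
  have hvred : ∀ w', wordProd M w' = wordProd M v → v.length ≤ w'.length := by
    intro w' hw'
    have := hred (w' ++ CoxeterSystem.alternatingWord s t m) (by rw [wordProd_append, hw', hv])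
    simp at this
    omega
  have hup : ∀ w', wordProd M w' = wordProd M v * simpleRefl M (if Even m then t else s) →
      v.length ≤ w'.length := by
    intro w' hw'
    have hprod : wordProd M w' * wordProd M (CoxeterSystem.alternatingWord s t (m + 1)) = g := by
      rw [CoxeterSystem.alternatingWord_succ', wordProd_cons, hw', mul_assoc,
        ← mul_assoc (simpleRefl M _), simpleRefl_mul_self hM, one_mul, hv]
    have := hred (w' ++ CoxeterSystem.alternatingWord s t (m + 1)) (by
      rw [wordProd_append, hprod])
    simp at this
    by_contra! hlt
    exact hmax ⟨w', by omega, hprod⟩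
  have hdown : ∀ w', wordProd M w' = wordProd M v * simpleRefl M (if Even m then s else t) →
      v.length ≤ w'.length := by
    intro w' hw'
    obtain ⟨k, rfl⟩ := Nat.exists_eq_add_of_le' hm1
    rw [CoxeterSystem.alternatingWord_succ', wordProd_cons, ← mul_assoc] at hv
    have hite : (if Even (k + 1) then s else t) = if Even k then t else s := by
      by_cases hk : Even k <;> simp [hk, Nat.even_add_one]
    rw [hite] at hw'
    have := hred (w' ++ CoxeterSystem.alternatingWord s t k) (by rw [wordProd_append, hw', hv])
    simp at this
    omega
  have hboth : 0 ≤ wordProd M v (Pi.single s 1) ∧ 0 ≤ wordProd M v (Pi.single t 1) := by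
    have h₁ := ih v.length (by omega) v _ rfl hvred hup
    have h₂ := ih v.length (by omega) v _ rfl hvred hdown
    split_ifs at h₁ h₂
    exacts [⟨h₂, h₁⟩, ⟨h₁, h₂⟩]
  rcases nonneg_or_exists_shorter hM hst m with ⟨x, y, hx, hy, hxy⟩ | ⟨u, hu, hus⟩
  · rw [← hv, Module.End.mul_apply, hxy, map_add, map_smul, map_smul]
    exact add_nonneg (smul_nonneg hx hboth.1) (smul_nonneg hy hboth.2)
  · have := hasc (v ++ u) (by rw [wordProd_append, hus, ← mul_assoc, hv])
    simp at this
    omega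

theorem exists_reduced_word (w : List I) : ∃ w₀, wordProd M w₀ = wordProd M w ∧
    ∀ w', wordProd M w' = wordProd M w₀ → w₀.length ≤ w'.length := by
  obtain ⟨w₀, h₀, hmin⟩ := exists_minimalFor_of_wellFoundedLT
    (fun w' => wordProd M w' = wordProd M w) List.length ⟨w, rfl⟩
  refine ⟨w₀, h₀, fun w' hw' => ?_⟩
  by_contra! hlt
  exact absurd (hmin (hw'.trans h₀) hlt.le) (by omega)

/-- Every real root is nonnegative or nonpositive. -/
theorem wordProd_single_nonneg_or_nonpos (hM : IsGCM M) (w : List I) (s : I) :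
    0 ≤ wordProd M w (Pi.single s 1) ∨ wordProd M w (Pi.single s 1) ≤ 0 := by
  obtain ⟨w₀, h₀, hred⟩ := exists_reduced_word (M := M) w
  rw [← h₀]
  by_cases hasc : ∀ w', wordProd M w' = wordProd M w₀ * simpleRefl M s → w₀.length ≤ w'.length
  · exact Or.inl (wordProd_single_nonneg hM _ w₀ s rfl hred hasc)
  · push Not at hasc
    obtain ⟨w₁, h₁, hlt⟩ := hasc
    obtain ⟨w₂, h₂, hred₂⟩ := exists_reduced_word (M := M) w₁
    have hback : wordProd M w₂ * simpleRefl M s = wordProd M w₀ := by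
      rw [h₂, h₁, mul_assoc, simpleRefl_mul_self hM, mul_one]
    have hle : w₂.length ≤ w₁.length := hred₂ w₁ h₂.symm
    have hpos := wordProd_single_nonneg hM _ w₂ s rfl hred₂ fun w' hw' => by
      have := hred w' (hw'.trans hback)
      omega
    right
    rw [← hback, Module.End.mul_apply, simpleRefl_single hM, map_neg]
    exact neg_nonpos.2 hpos

theorem fire_dotProduct (lam β : I → ℝ) (i : I) :
    fire M lam i ⬝ᵥ β = lam ⬝ᵥ simpleRefl M i β := by
  rw [simpleRefl_apply, dotProduct_sub, dotProduct_smul, dotProduct_single_one]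
  simp only [dotProduct, fire, sub_mul, Finset.sum_sub_distrib, smul_eq_mul, Finset.sum_mul]
  congr 1
  exact Finset.sum_congr rfl fun k _ => by ring

/-- A convergent game transfers to any position whose signs on roots are weakly compatible. -/
theorem exists_convGame_of_sign_compatible (s : List I) (lam mu : I → ℝ)
    (hpos : ∀ w i, 0 < lam ⬝ᵥ wordProd M w (Pi.single i 1) →
      0 ≤ mu ⬝ᵥ wordProd M w (Pi.single i 1))
    (hnonpos : ∀ w i, lam ⬝ᵥ wordProd M w (Pi.single i 1) ≤ 0 →
      mu ⬝ᵥ wordProd M w (Pi.single i 1) ≤ 0)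
    (h : ConvGame M lam s) : ∃ s', ConvGame M mu s' := by
  induction s generalizing lam mu with
  | nil =>
    refine ⟨[], trivial, fun i => ?_⟩
    simpa [fireList] using hnonpos [] i (by simpa [fireList] using h.2 i)
  | cons i s ih =>
    obtain ⟨s', hs'⟩ := ih (fire M lam i) (fire M mu i)
      (fun w k hk => by
        rw [fire_dotProduct, ← Module.End.mul_apply, ← wordProd_cons] at hk ⊢
        exact hpos _ _ hk)
      (fun w k hk => by
        rw [fire_dotProduct, ← Module.End.mul_apply, ← wordProd_cons] at hk ⊢
        exact hnonpos _ _ hk)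
      ⟨h.1.2, h.2⟩
    have hi : 0 ≤ mu i := by simpa using hpos [] i (by simpa using h.1.1)
    rcases hi.lt_or_eq with hlt | heq
    · exact ⟨i :: s', ⟨hlt, hs'.1⟩, hs'.2⟩
    · have : fire M mu i = mu := by
        ext k
        simp [fire, ← heq]
      exact ⟨s', this ▸ hs'⟩

end WordProd

/-- If `lam` is a dominant position with `lam j > 0` and some game sequence from `lam`
converges, then some game sequence from the fundamental position `ω_j` converges. -/
theorem fundamental_converges {I : Type*} [Fintype I] [DecidableEq I]
    (M : I → I → ℤ) (hM : IsGCM M) (lam : I → ℝ)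
    (hdom : ∀ i, 0 ≤ lam i) (j : I) (hj : 0 < lam j)
    (h : ∃ s : List I, ConvGame M lam s) :
    ∃ s : List I, ConvGame M (fun i => if i = j then 1 else 0) s := by
  obtain ⟨s, hs⟩ := h
  have hdot (β : I → ℝ) : (fun i => if i = j then (1 : ℝ) else 0) ⬝ᵥ β = β j := by
    simp [dotProduct]
  refine exists_convGame_of_sign_compatible s lam _ (fun w i hi => ?_) (fun w i hi => ?_) hs <;>
    rw [hdot] <;> rcases wordProd_single_nonneg_or_nonpos hM w i with h | h
  · exact h j
  · exact absurd hi (not_lt.2 (Finset.sum_nonpos fun k _ =>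
      mul_nonpos_of_nonneg_of_nonpos (hdom k) (h k)))
  · have hle := (Finset.single_le_sum (fun k _ => mul_nonneg (hdom k) (h k))
      (Finset.mem_univ j)).trans hi
    exact nonpos_of_mul_nonpos_right hle hj
  · exact h j
end
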